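/- Fix β > 0 and δ ∈ (0, 1/2]. Almost surely there exists a sequence (ε_d)_{d∈ℕ} of real numbers with lim_{d→∞} d^{1/2−δ} ε_d = 0 such that lim_{d→∞} max_{1≤i≤d} | s_i(√d · A_d) − (1+ε_d) s_i(Y_d) | = 0. -/

import Mathlib

open MeasureTheory ProbabilityTheory Filter Matrix Real

/-- Descending singular values: `sVal M i` is the `(i+1)`-st largest singular value of `M`,
i.e. the square root of the `(i+1)`-st largest eigenvalue of `M Mᵀ`. -/
noncomputable def sVal {d : ℕ} (M : Matrix (Fin d) (Fin d) ℝ) (i : Fin d) : ℝ :=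
  Real.sqrt ((Matrix.isHermitian_mul_conjTranspose_self M).eigenvalues
    (Tuple.sort (Matrix.isHermitian_mul_conjTranspose_self M).eigenvalues i.rev))

/-- The score matrix `S_d = W^Q_d (W^K_d)ᵀ / √d`. -/
noncomputable def scoreS {Ω : Type*} (WQ WK : (d : ℕ) → Ω → Fin d → Fin d → ℝ)
    (d : ℕ) (ω : Ω) : Matrix (Fin d) (Fin d) ℝ :=
  (Real.sqrt d)⁻¹ • (Matrix.of (WQ d ω) * (Matrix.of (WK d ω))ᵀ)

/-- The attention matrix `A_d` with entries `exp(β S_ij) / Z_i`,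
where `Z_i = Σ_j exp(β S_ij)`. -/
noncomputable def attn {Ω : Type*} (β : ℝ) (WQ WK : (d : ℕ) → Ω → Fin d → Fin d → ℝ)
    (d : ℕ) (ω : Ω) : Matrix (Fin d) (Fin d) ℝ :=
  Matrix.of fun i j =>
    Real.exp (β * scoreS WQ WK d ω i j) / ∑ k, Real.exp (β * scoreS WQ WK d ω i k)

/-- `Y_d = exp(β S_d)/(e^{β²/2} √d)`, with `exp` applied entrywise. -/
noncomputable def Ymat {Ω : Type*} (β : ℝ) (WQ WK : (d : ℕ) → Ω → Fin d → Fin d → ℝ)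
    (d : ℕ) (ω : Ω) : Matrix (Fin d) (Fin d) ℝ :=
  Matrix.of fun i j =>
    Real.exp (β * scoreS WQ WK d ω i j) / (Real.exp (β ^ 2 / 2) * Real.sqrt d)

section SingularValues

lemma exists_spectral_form {d : ℕ} (M : Matrix (Fin d) (Fin d) ℝ) :
    ∃ b : OrthonormalBasis (Fin d) ℝ (EuclideanSpace ℝ (Fin d)),
      ∀ x : EuclideanSpace ℝ (Fin d),
        (Mᵀ *ᵥ x.ofLp) ⬝ᵥ (Mᵀ *ᵥ x.ofLp) = ∑ j, sVal M j ^ 2 * inner ℝ (b j) x ^ 2 := by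
  set hM := Matrix.isHermitian_mul_conjTranspose_self M with hMdef
  set σ : Equiv.Perm (Fin d) := Fin.revPerm.trans (Tuple.sort hM.eigenvalues) with hσ
  have hs : ∀ j, sVal M j ^ 2 = hM.eigenvalues (σ j) := fun j => by
    rw [sVal, Real.sq_sqrt]
    · rfl
    · exact (Matrix.posSemidef_self_mul_conjTranspose M).eigenvalues_nonneg _
  refine ⟨hM.eigenvectorBasis.reindex σ.symm, fun x => ?_⟩
  simp only [hs, OrthonormalBasis.reindex_apply, Equiv.symm_symm]
  rw [Equiv.sum_comp σ (fun j => hM.eigenvalues j * inner ℝ (hM.eigenvectorBasis j) x ^ 2)]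
  have h1 : (Mᵀ *ᵥ x.ofLp) ⬝ᵥ (Mᵀ *ᵥ x.ofLp)
      = inner ℝ x (WithLp.toLp 2 ((M * Mᴴ) *ᵥ x.ofLp)) := by
    rw [EuclideanSpace.inner_eq_star_dotProduct]
    simp only [star_trivial, ← Matrix.mulVec_mulVec, Matrix.conjTranspose_eq_transpose_of_trivial]
    rw [Matrix.dotProduct_mulVec, ← Matrix.mulVec_transpose, Matrix.transpose_transpose]
  rw [h1, ← hM.eigenvectorBasis.sum_inner_mul_inner]
  refine Finset.sum_congr rfl fun j _ => ?_
  have h2 : inner ℝ (hM.eigenvectorBasis j) (WithLp.toLp 2 ((M * Mᴴ) *ᵥ x.ofLp))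
      = hM.eigenvalues j * inner ℝ (hM.eigenvectorBasis j) x := by
    simp only [EuclideanSpace.inner_eq_star_dotProduct, star_trivial]
    rw [dotProduct_comm, Matrix.dotProduct_mulVec, ← Matrix.mulVec_transpose]
    have h3 : (M * Mᴴ)ᵀ = M * Mᴴ := by
      simp [Matrix.transpose_mul, Matrix.conjTranspose_eq_transpose_of_trivial]
    rw [h3, hM.mulVec_eigenvectorBasis, smul_dotProduct, smul_eq_mul, dotProduct_comm]
  rw [h2, real_inner_comm]
  ring

lemma sVal_nonneg {d : ℕ} (M : Matrix (Fin d) (Fin d) ℝ) (i : Fin d) : 0 ≤ sVal M i :=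
  Real.sqrt_nonneg _

lemma sVal_antitone {d : ℕ} (M : Matrix (Fin d) (Fin d) ℝ) : Antitone (sVal M) := by
  intro i j hij
  exact Real.sqrt_le_sqrt (Tuple.monotone_sort
    (Matrix.isHermitian_mul_conjTranspose_self M).eigenvalues (Fin.rev_le_rev.mpr hij))

lemma exists_ne_zero_of_card_lt {d : ℕ} {ι : Type*} [Fintype ι] (h : Fintype.card ι < d)
    (φ : ι → EuclideanSpace ℝ (Fin d) →ₗ[ℝ] ℝ) : ∃ x, x ≠ 0 ∧ ∀ i, φ i x = 0 := by
  have hker : LinearMap.ker (LinearMap.pi φ) ≠ ⊥ :=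
    LinearMap.ker_ne_bot_of_finrank_lt (by simpa using h)
  obtain ⟨x, hx, hx0⟩ := (Submodule.ne_bot_iff _).1 hker
  exact ⟨x, hx0, fun i => congrFun hx i⟩

lemma sq_mul_norm_le_form {d : ℕ} {M : Matrix (Fin d) (Fin d) ℝ}
    {b : OrthonormalBasis (Fin d) ℝ (EuclideanSpace ℝ (Fin d))} {x : EuclideanSpace ℝ (Fin d)}
    {i : Fin d} (hx : ∀ j, i < j → inner ℝ (b j) x = 0) :
    sVal M i ^ 2 * ‖x‖ ^ 2 ≤ ∑ j, sVal M j ^ 2 * inner ℝ (b j) x ^ 2 := by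
  rw [← b.sum_sq_inner_right, Finset.mul_sum]
  refine Finset.sum_le_sum fun j _ => ?_
  rcases lt_or_ge i j with h | h
  · simp [hx j h]
  · have := sVal_antitone M h
    have := sVal_nonneg M i
    gcongr

lemma form_le_sq_mul_norm {d : ℕ} {M : Matrix (Fin d) (Fin d) ℝ}
    {b : OrthonormalBasis (Fin d) ℝ (EuclideanSpace ℝ (Fin d))} {x : EuclideanSpace ℝ (Fin d)}
    {i : Fin d} (hx : ∀ j, j < i → inner ℝ (b j) x = 0) :
    ∑ j, sVal M j ^ 2 * inner ℝ (b j) x ^ 2 ≤ sVal M i ^ 2 * ‖x‖ ^ 2 := by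
  rw [← b.sum_sq_inner_right, Finset.mul_sum]
  refine Finset.sum_le_sum fun j _ => ?_
  rcases lt_or_ge j i with h | h
  · simp [hx j h]
  · have := sVal_antitone M h
    have := sVal_nonneg M j
    gcongr

/-- Multiplicative perturbation bound for singular values. -/
lemma sVal_diagonal_mul_le {d : ℕ} (M : Matrix (Fin d) (Fin d) ℝ) (D : Fin d → ℝ) {κ : ℝ}
    (hκ : 0 ≤ κ) (hD : ∀ i, |D i| ≤ κ) (i : Fin d) :
    sVal (Matrix.diagonal D * M) i ≤ κ * sVal M i := by
  obtain ⟨b, hb⟩ := exists_spectral_form (Matrix.diagonal D * M)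
  obtain ⟨c, hc⟩ := exists_spectral_form M
  set T : EuclideanSpace ℝ (Fin d) →ₗ[ℝ] EuclideanSpace ℝ (Fin d) :=
    Matrix.toEuclideanLin (Matrix.diagonal D) with hT
  obtain ⟨x, hx0, hx⟩ := exists_ne_zero_of_card_lt (d := d) (ι := {j : Fin d // j ≠ i})
    (by
      rw [Fintype.card_subtype_compl]
      have := i.pos
      simp
      omega)
    (fun j => if j.1 < i then (innerₛₗ ℝ (c j.1)) ∘ₗ T else innerₛₗ ℝ (b j.1))
  have h1 : ∀ j, i < j → inner ℝ (b j) x = 0 := fun j hj => by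
    have := hx ⟨j, hj.ne'⟩
    simpa [hj.le, not_lt.2 hj.le] using this
  have h2 : ∀ j, j < i → inner ℝ (c j) (T x) = 0 := fun j hj => by
    have := hx ⟨j, hj.ne⟩
    simpa [hj] using this
  have h3 := sq_mul_norm_le_form (M := Matrix.diagonal D * M) h1
  have h4 := form_le_sq_mul_norm (M := M) h2
  rw [← hb] at h3
  rw [← hc] at h4
  have h5 : (Matrix.diagonal D * M)ᵀ *ᵥ x.ofLp = Mᵀ *ᵥ (T x).ofLp := by
    simp [hT, Matrix.transpose_mul, Matrix.mulVec_mulVec]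
  rw [h5] at h3
  have h6 : ‖T x‖ ^ 2 ≤ κ ^ 2 * ‖x‖ ^ 2 := by
    rw [EuclideanSpace.norm_sq_eq, EuclideanSpace.norm_sq_eq, Finset.mul_sum]
    refine Finset.sum_le_sum fun j _ => ?_
    have : (T x).ofLp j = D j * x.ofLp j := by
      simp [hT, Matrix.mulVec_diagonal]
    rw [this, norm_mul, mul_pow]
    have := hD j
    gcongr
    exact this
  have hxpos : 0 < ‖x‖ ^ 2 := by positivity
  have h7 : sVal (Matrix.diagonal D * M) i ^ 2 * ‖x‖ ^ 2 ≤ (κ * sVal M i) ^ 2 * ‖x‖ ^ 2 := by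
    calc _ ≤ _ := h3
      _ ≤ _ := h4
      _ ≤ sVal M i ^ 2 * (κ ^ 2 * ‖x‖ ^ 2) := by gcongr
      _ = _ := by ring
  have h8 := le_of_mul_le_mul_right h7 hxpos
  exact le_of_sq_le_sq h8 (mul_nonneg hκ (sVal_nonneg M i))

/-- If `M Mᵀ` is entrywise close to the all-ones matrix off the diagonal, then all singular values
of `M` but the largest one are small. -/
lemma sVal_sq_le_of_entrywise {d : ℕ} (M : Matrix (Fin d) (Fin d) ℝ) {t C : ℝ}
    (hM : ∀ i k, |(M * Mᵀ) i k - 1| ≤ t + if i = k then C else 0)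
    {i : Fin d} (hi : 0 < i.1) : sVal M i ^ 2 ≤ t * d + C := by
  obtain ⟨b, hb⟩ := exists_spectral_form M
  set one : EuclideanSpace ℝ (Fin d) := WithLp.toLp 2 (fun _ => 1) with hone
  obtain ⟨x, hx0, hx⟩ := exists_ne_zero_of_card_lt (d := d) (ι := Option {j : Fin d // i < j})
    (by
      rw [Fintype.card_option, Fintype.card_subtype]
      have := i.2
      have h : (Finset.univ.filter fun j => i < j) = Finset.Ioi i := by ext; simp
      rw [h, Fin.card_Ioi]
      omega)
    (fun j => j.elim (innerₛₗ ℝ one) (fun j => innerₛₗ ℝ (b j.1)))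
  have h1 : ∀ j, i < j → inner ℝ (b j) x = 0 := fun j hj => hx (some ⟨j, hj⟩)
  have h2 : ∑ j, x.ofLp j = 0 := by
    have := hx none
    simpa [hone, EuclideanSpace.inner_eq_star_dotProduct, dotProduct] using this
  have h3 := sq_mul_norm_le_form (M := M) h1
  rw [← hb] at h3
  have hxpos : 0 < ‖x‖ ^ 2 := by positivity
  refine le_of_mul_le_mul_right (h3.trans ?_) hxpos
  have h4 : (Mᵀ *ᵥ x.ofLp) ⬝ᵥ (Mᵀ *ᵥ x.ofLp)
      = ∑ k, ∑ l, ((M * Mᵀ) k l - 1) * (x.ofLp k * x.ofLp l) := by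
    have e1 : (Mᵀ *ᵥ x.ofLp) ⬝ᵥ (Mᵀ *ᵥ x.ofLp)
        = ∑ k, ∑ l, (M * Mᵀ) k l * (x.ofLp k * x.ofLp l) := by
      rw [Matrix.dotProduct_mulVec, Matrix.vecMul_transpose, Matrix.mulVec_mulVec]
      simp only [dotProduct, Matrix.mulVec, Finset.sum_mul]
      exact Finset.sum_congr rfl fun k _ => Finset.sum_congr rfl fun l _ => by ring
    have e2 : ∑ k, ∑ l, x.ofLp k * x.ofLp l = 0 := by
      rw [← Finset.sum_mul_sum, h2, zero_mul]
    rw [e1, ← sub_zero (∑ k, ∑ l, (M * Mᵀ) k l * (x.ofLp k * x.ofLp l)), ← e2,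
      ← Finset.sum_sub_distrib]
    refine Finset.sum_congr rfl fun k _ => ?_
    rw [← Finset.sum_sub_distrib]
    exact Finset.sum_congr rfl fun l _ => by ring
  have ht : 0 ≤ t := by
    have h0 : (⟨0, i.pos⟩ : Fin d) ≠ i := fun h => by
      rw [← h] at hi
      simp at hi
    have := hM _ _ |>.trans' (abs_nonneg ((M * Mᵀ) ⟨0, i.pos⟩ i - 1))
    simpa [h0] using this
  have hnorm : ‖x‖ ^ 2 = ∑ k, |x.ofLp k| ^ 2 := by
    rw [EuclideanSpace.norm_sq_eq]
    rfl
  calc (Mᵀ *ᵥ x.ofLp) ⬝ᵥ (Mᵀ *ᵥ x.ofLp)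
      ≤ ∑ k, ∑ l, (t + if k = l then C else 0) * (|x.ofLp k| * |x.ofLp l|) := by
        rw [h4]
        refine Finset.sum_le_sum fun k _ => Finset.sum_le_sum fun l _ => ?_
        refine (le_abs_self _).trans ?_
        rw [abs_mul, abs_mul]
        exact mul_le_mul_of_nonneg_right (hM k l) (by positivity)
    _ = t * (∑ k, |x.ofLp k|) ^ 2 + C * ‖x‖ ^ 2 := by
        simp only [add_mul, Finset.sum_add_distrib, ite_mul, zero_mul, Finset.sum_ite_eq,
          Finset.mem_univ, if_true]
        rw [hnorm, sq, Finset.sum_mul_sum, Finset.mul_sum, Finset.mul_sum]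
        simp only [Finset.mul_sum]
        congr 1
        exact Finset.sum_congr rfl fun k _ => by ring
    _ ≤ t * (d * ‖x‖ ^ 2) + C * ‖x‖ ^ 2 := by
        have := sq_sum_le_card_mul_sum_sq (s := Finset.univ) (f := fun k => |x.ofLp k|)
        rw [Finset.card_univ, Fintype.card_fin, ← hnorm] at this
        gcongr
    _ = (t * d + C) * ‖x‖ ^ 2 := by ring

end SingularValues

section Moments

lemma add_pow_even_le (p : ℕ) (s x : ℝ) :
    (s + x) ^ (2 * (p + 1)) ≤ s ^ (2 * (p + 1)) + (2 * (p + 1) : ℕ) * (s ^ (2 * p + 1) * x)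
      + 4 ^ (p + 1) * (s ^ (2 * p) * x ^ 2 + x ^ (2 * (p + 1))) := by
  have hterm : ∀ k, s ^ (2 * p - k) * x ^ (k + 2) ≤ s ^ (2 * p) * x ^ 2 + x ^ (2 * (p + 1))
      ∨ 2 * p < k := by
    intro k
    by_cases hk : 2 * p < k
    · exact Or.inr hk
    left
    push Not at hk
    have e1 : s ^ (2 * p) * x ^ 2 = |s| ^ (2 * p) * |x| ^ 2 := by
      rw [sq_abs, Even.pow_abs (by simp)]
    have e2 : x ^ (2 * (p + 1)) = |x| ^ (2 * (p + 1)) := by rw [Even.pow_abs (by simp)]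
    rw [e1, e2]
    refine (le_abs_self _).trans ?_
    rw [abs_mul, abs_pow, abs_pow]
    have hs := abs_nonneg s
    have hx := abs_nonneg x
    rcases le_total |x| |s| with h | h
    · have : |s| ^ (2 * p - k) * |x| ^ (k + 2) ≤ |s| ^ (2 * p) * |x| ^ 2 := by
        calc |s| ^ (2 * p - k) * |x| ^ (k + 2)
            = |s| ^ (2 * p - k) * |x| ^ k * |x| ^ 2 := by ring
          _ ≤ |s| ^ (2 * p - k) * |s| ^ k * |x| ^ 2 := by gcongr
          _ = _ := by rw [← pow_add, Nat.sub_add_cancel hk]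
      linarith [pow_nonneg hx (2 * (p + 1))]
    · have : |s| ^ (2 * p - k) * |x| ^ (k + 2) ≤ |x| ^ (2 * (p + 1)) := by
        calc |s| ^ (2 * p - k) * |x| ^ (k + 2)
            ≤ |x| ^ (2 * p - k) * |x| ^ (k + 2) := by gcongr
          _ = _ := by rw [← pow_add]; congr 1; omega
      linarith [mul_nonneg (pow_nonneg hs (2 * p)) (pow_nonneg hx 2)]
  have hR : 0 ≤ s ^ (2 * p) * x ^ 2 + x ^ (2 * (p + 1)) :=
    add_nonneg (mul_nonneg (Even.pow_nonneg (by simp) _) (sq_nonneg _))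
      (Even.pow_nonneg (by simp) _)
  have hexp : (s + x) ^ (2 * (p + 1)) = s ^ (2 * (p + 1))
      + (2 * (p + 1) : ℕ) * (s ^ (2 * p + 1) * x)
      + ∑ k ∈ Finset.range (2 * p + 1),
        s ^ (2 * p - k) * x ^ (k + 2) * ((2 * (p + 1)).choose (k + 2)) := by
    rw [add_comm s x, add_pow, show 2 * (p + 1) + 1 = (2 * p + 1) + 1 + 1 by ring,
      Finset.sum_range_succ', Finset.sum_range_succ']
    have e : ∀ k ∈ Finset.range (2 * p + 1),
        x ^ (k + 1 + 1) * s ^ (2 * (p + 1) - (k + 1 + 1)) * ((2 * (p + 1)).choose (k + 1 + 1) : ℝ)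
        = s ^ (2 * p - k) * x ^ (k + 2) * ((2 * (p + 1)).choose (k + 2)) := by
      intro k _
      rw [show 2 * (p + 1) - (k + 1 + 1) = 2 * p - k by omega]
      ring
    rw [Finset.sum_congr rfl e]
    simp only [zero_add, pow_one, pow_zero, Nat.choose_one_right, Nat.choose_zero_right,
      Nat.sub_zero, show 2 * (p + 1) - 1 = 2 * p + 1 by omega]
    push_cast
    ring
  have hchoose : ∑ k ∈ Finset.range (2 * p + 1), ((2 * (p + 1)).choose (k + 2) : ℝ)
      ≤ 4 ^ (p + 1) := by
    have h := Nat.sum_range_choose (2 * (p + 1))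
    rw [show 2 * (p + 1) + 1 = (2 * p + 1) + 1 + 1 by ring,
      Finset.sum_range_succ', Finset.sum_range_succ', pow_mul] at h
    have h' : ∑ k ∈ Finset.range (2 * p + 1), (2 * (p + 1)).choose (k + 2) ≤ (2 ^ 2) ^ (p + 1) :=
      h ▸ (Nat.le_add_right _ _).trans (Nat.le_add_right _ _)
    norm_num only at h'
    exact_mod_cast h'
  rw [hexp]
  gcongr
  calc _ ≤ ∑ k ∈ Finset.range (2 * p + 1), (s ^ (2 * p) * x ^ 2 + x ^ (2 * (p + 1)))
        * ((2 * (p + 1)).choose (k + 2) : ℝ) := by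
        refine Finset.sum_le_sum fun k hk => ?_
        refine mul_le_mul_of_nonneg_right ?_ (by positivity)
        exact (hterm k).resolve_right (by simp at hk; omega)
    _ ≤ _ := by
        rw [← Finset.mul_sum, mul_comm]
        gcongr

/-- The constant in the moment bound `integral_sum_pow_le`, for summands whose `2 k`-th moments are
at most `B k`. -/
noncomputable def momentConst (B : ℕ → ℝ) : ℕ → ℝ
  | 0 => 1
  | p + 1 => 4 ^ (p + 1) * (momentConst B p * B 1 + B (p + 1))

lemma momentConst_nonneg {B : ℕ → ℝ} (hB : ∀ k, 0 ≤ B k) : ∀ p, 0 ≤ momentConst B p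
  | 0 => zero_le_one
  | p + 1 => by
    have := momentConst_nonneg hB p
    have := hB 1
    have := hB (p + 1)
    simp only [momentConst]
    positivity

lemma integrable_pow_of_memLp {Ω : Type*} [MeasurableSpace Ω] {μ : Measure Ω}
    [IsProbabilityMeasure μ] {X : Ω → ℝ} (h : ∀ p : ℕ, MemLp X p μ) (k : ℕ) :
    Integrable (fun ω => X ω ^ k) μ := by
  refine ((h k).integrable_norm_pow').mono' ((h k).1.pow k) ?_
  filter_upwards with ω
  simp

/-- Moments of sums of independent centred variables grow diffusively. -/
lemma integral_sum_pow_le {Ω ι : Type*} [MeasurableSpace Ω] {μ : Measure Ω}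
    [IsProbabilityMeasure μ] {X : ι → Ω → ℝ} {B : ℕ → ℝ} (hB : ∀ k, 0 ≤ B k)
    (hX : ∀ i, ∀ p : ℕ, MemLp (X i) p μ) (h0 : ∀ i, ∫ ω, X i ω ∂μ = 0)
    (hXB : ∀ i k, ∫ ω, X i ω ^ (2 * k) ∂μ ≤ B k)
    (hind : ∀ (s : Finset ι) (a : ι), a ∉ s → IndepFun (fun ω => ∑ i ∈ s, X i ω) (X a) μ)
    (p : ℕ) (s : Finset ι) :
    ∫ ω, (∑ i ∈ s, X i ω) ^ (2 * p) ∂μ ≤ momentConst B p * (s.card : ℝ) ^ p := by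
  classical
  induction p generalizing s with
  | zero => simp [momentConst]
  | succ p ihp =>
    induction s using Finset.induction_on with
    | empty => simp
    | insert a s ha ihs =>
      set S : Ω → ℝ := fun ω => ∑ i ∈ s, X i ω with hS
      have hSm : ∀ q : ℕ, MemLp S q μ := fun q => memLp_finsetSum s fun i _ => hX i q
      have hSi := integrable_pow_of_memLp hSm
      have hXi := integrable_pow_of_memLp (hX a)
      have hI := hind s a ha
      have hI1 : IndepFun (fun ω => S ω ^ (2 * p + 1)) (X a) μ :=
        hI.comp (φ := fun y => y ^ (2 * p + 1)) (ψ := id) (by fun_prop) measurable_id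
      have hI2 : IndepFun (fun ω => S ω ^ (2 * p)) (fun ω => X a ω ^ 2) μ :=
        hI.comp (φ := fun y => y ^ (2 * p)) (ψ := fun y => y ^ 2) (by fun_prop) (by fun_prop)
      have i1 : Integrable (fun ω => S ω ^ (2 * p + 1) * X a ω) μ :=
        hI1.integrable_mul (hSi _) (by simpa using hXi 1)
      have i2 : Integrable (fun ω => S ω ^ (2 * p) * X a ω ^ 2) μ :=
        hI2.integrable_mul (hSi _) (hXi _)
      have e1 : ∫ ω, S ω ^ (2 * p + 1) * X a ω ∂μ = 0 := by
        rw [hI1.integral_fun_mul_eq_mul_integral (hSi _).1 (hX a 1).1, h0, mul_zero]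
      have e2 : ∫ ω, S ω ^ (2 * p) * X a ω ^ 2 ∂μ ≤ momentConst B p * (s.card : ℝ) ^ p * B 1 := by
        rw [hI2.integral_fun_mul_eq_mul_integral (hSi _).1 (hXi _).1]
        have h1 := hXB a 1
        have h2 : 0 ≤ ∫ ω, X a ω ^ 2 ∂μ := integral_nonneg fun ω => sq_nonneg _
        have := momentConst_nonneg hB p
        refine mul_le_mul (ihp s) h1 h2 (by positivity)
      have hc : ((insert a s).card : ℝ) = s.card + 1 := by simp [ha]
      have hle : ∫ ω, (∑ i ∈ insert a s, X i ω) ^ (2 * (p + 1)) ∂μ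
          ≤ ∫ ω, (S ω ^ (2 * (p + 1)) + (2 * (p + 1) : ℕ) * (S ω ^ (2 * p + 1) * X a ω)
            + 4 ^ (p + 1) * (S ω ^ (2 * p) * X a ω ^ 2 + X a ω ^ (2 * (p + 1)))) ∂μ := by
        refine integral_mono ?_ ?_ fun ω => ?_
        · exact integrable_pow_of_memLp
            (fun q => memLp_finsetSum (insert a s) fun i _ => hX i q) _
        · exact ((hSi _).add (i1.const_mul _)).add ((i2.add (hXi _)).const_mul _)
        · simp only [Finset.sum_insert ha]
          rw [add_comm (X a ω)]
          exact add_pow_even_le p (S ω) (X a ω)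
      refine hle.trans ?_
      rw [integral_add (by fun_prop) (by fun_prop), integral_add (by fun_prop) (by fun_prop),
        integral_const_mul, integral_const_mul, integral_add (by fun_prop) (by fun_prop), e1, hc]
      have hB1 := hB 1
      have hBp := hB (p + 1)
      have hm := momentConst_nonneg hB p
      have hXp := hXB a (p + 1)
      have hn : (0 : ℝ) ≤ s.card := Nat.cast_nonneg _
      set n : ℝ := (s.card : ℝ)
      have hnp : n ^ p ≤ (n + 1) ^ p := by gcongr; linarith
      have h1p : 1 ≤ (n + 1) ^ p := one_le_pow₀ (by linarith)
      have hmc : momentConst B (p + 1) = 4 ^ (p + 1) * (momentConst B p * B 1 + B (p + 1)) := rfl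
      have hmc0 := momentConst_nonneg hB (p + 1)
      calc _ ≤ momentConst B (p + 1) * n ^ (p + 1) + 0
            + 4 ^ (p + 1) * (momentConst B p * n ^ p * B 1 + B (p + 1)) := by
            simp only [mul_zero]
            gcongr
        _ ≤ momentConst B (p + 1) * (n * (n + 1) ^ p) + 0
            + 4 ^ (p + 1) * (momentConst B p * (n + 1) ^ p * B 1 + B (p + 1) * (n + 1) ^ p) := by
            rw [pow_succ' n]
            gcongr
            nlinarith
        _ = momentConst B (p + 1) * (n + 1) ^ (p + 1) := by
            rw [hmc]; ring

/-- Polynomial tail bound for sums of independent centred variables. -/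
lemma measure_abs_sum_ge_le {Ω : Type*} [MeasurableSpace Ω] {μ : Measure Ω}
    [IsProbabilityMeasure μ] {n : ℕ} {X : Fin n → Ω → ℝ} {B : ℕ → ℝ} (hB : ∀ k, 0 ≤ B k)
    (hX : ∀ i, ∀ p : ℕ, MemLp (X i) p μ) (h0 : ∀ i, ∫ ω, X i ω ∂μ = 0)
    (hXB : ∀ i k, ∫ ω, X i ω ^ (2 * k) ∂μ ≤ B k)
    (hind : ∀ (s : Finset (Fin n)) (a : Fin n), a ∉ s →
      IndepFun (fun ω => ∑ i ∈ s, X i ω) (X a) μ)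
    {η : ℝ} {p : ℕ} (hp : 2 ≤ p * η) (hn : 0 < n) :
    μ {ω | (n : ℝ) ^ (1 / 2 + η) ≤ |∑ i, X i ω|} ≤
      ENNReal.ofReal (momentConst B p * ((n : ℝ) ^ 4)⁻¹) := by
  set S : Ω → ℝ := fun ω => ∑ i, X i ω with hS
  have hn' : (1 : ℝ) ≤ n := by exact_mod_cast hn
  have hSi : Integrable (fun ω => S ω ^ (2 * p)) μ :=
    integrable_pow_of_memLp (fun q => memLp_finsetSum _ fun i _ => hX i q) _
  have hmom := integral_sum_pow_le hB hX h0 hXB hind p Finset.univ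
  rw [Finset.card_univ, Fintype.card_fin] at hmom
  have hmc := momentConst_nonneg hB p
  have hpow : (n : ℝ) ^ (p + 4) ≤ ((n : ℝ) ^ (1 / 2 + η)) ^ (2 * p) := by
    rw [← Real.rpow_natCast, ← Real.rpow_natCast, ← Real.rpow_mul (by positivity)]
    refine Real.rpow_le_rpow_of_exponent_le hn' ?_
    push_cast
    linarith
  have hmark := mul_meas_ge_le_integral_of_nonneg
    (Eventually.of_forall fun ω => Even.pow_nonneg (by simp) (S ω)) hSi ((n : ℝ) ^ (p + 4))
  have hsub : {ω | (n : ℝ) ^ (1 / 2 + η) ≤ |S ω|} ⊆ {ω | (n : ℝ) ^ (p + 4) ≤ S ω ^ (2 * p)} := by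
    intro ω hω
    simp only [Set.mem_ofPred_eq] at hω ⊢
    rw [← Even.pow_abs (by simp : Even (2 * p)) (S ω)]
    exact hpow.trans (by gcongr)
  refine (measure_mono hsub).trans ?_
  rw [← ofReal_measureReal]
  refine ENNReal.ofReal_le_ofReal ?_
  have h1 : (n : ℝ) ^ (p + 4) * μ.real {ω | (n : ℝ) ^ (p + 4) ≤ S ω ^ (2 * p)}
      ≤ momentConst B p * (n : ℝ) ^ p := hmark.trans hmom
  rw [show momentConst B p * (n : ℝ) ^ p = (n : ℝ) ^ p * momentConst B p from mul_comm _ _,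
    show ∀ y : ℝ, (n : ℝ) ^ (p + 4) * y = (n : ℝ) ^ p * ((n : ℝ) ^ 4 * y) from
      fun y => by ring] at h1
  have h2 := le_of_mul_le_mul_left h1 (by positivity)
  rw [← div_eq_mul_inv, le_div_iff₀ (by positivity)]
  linarith

end Moments

section Gaussian

lemma memLp_pi_eval {ι E : Type*} [Fintype ι] [MeasurableSpace E] {γ : Measure E}
    [IsProbabilityMeasure γ] {f : E → ℝ} {p : ENNReal} (hf : MemLp f p γ) (i : ι) :
    MemLp (fun x : ι → E => f (x i)) p (Measure.pi fun _ => γ) :=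
  hf.comp_measurePreserving (measurePreserving_eval (fun _ => γ) i)

lemma integral_pi_eval {ι E : Type*} [Fintype ι] [MeasurableSpace E] {γ : Measure E}
    [IsProbabilityMeasure γ] {f : E → ℝ} (hf : Measurable f) (i : ι) :
    ∫ x : ι → E, f (x i) ∂(Measure.pi fun _ => γ) = ∫ y, f y ∂γ := by
  have h := measurePreserving_eval (fun _ : ι => γ) i
  have e := integral_map (f := f) (μ := Measure.pi fun _ : ι => γ)
    h.measurable.aemeasurable hf.aestronglyMeasurable
  rw [h.map_eq] at e
  exact e.symm

/-- The law of an `m × n` matrix with independent standard Gaussian entries. -/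
noncomputable abbrev gaussianMatrix (m n : ℕ) : Measure (Fin m → Fin n → ℝ) :=
  Measure.pi fun _ => Measure.pi fun _ => gaussianReal 0 1

lemma iIndepFun_gaussianMatrix (m n : ℕ) :
    iIndepFun (fun (q : Fin m × Fin n) (Q : Fin m → Fin n → ℝ) => Q q.1 q.2)
      (gaussianMatrix m n) := by
  refine iIndepFun_uncurry' (X := fun i l (Q : Fin m → Fin n → ℝ) => Q i l) (by fun_prop) ?_ ?_
  · exact iIndepFun_pi (X := fun _ x => x) (fun _ => aemeasurable_id)
  · intro i
    have h := iIndepFun_pi (μ := fun _ : Fin n => gaussianReal 0 1) (X := fun _ (x : ℝ) => x)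
      (fun _ => aemeasurable_id)
    rw [iIndepFun_iff_map_fun_eq_pi_map (fun l => Measurable.aemeasurable (by fun_prop))] at h ⊢
    have he := measurePreserving_eval
      (fun _ : Fin m => Measure.pi fun _ : Fin n => gaussianReal 0 1) i
    have e1 : ∀ l, (gaussianMatrix m n).map (fun Q => Q i l)
        = (Measure.pi fun _ : Fin n => gaussianReal 0 1).map (fun x => x l) := fun l => by
      rw [← he.map_eq, Measure.map_map (by fun_prop) (by fun_prop)]
      rfl
    simp only [e1]
    rw [← h, ← he.map_eq, Measure.map_map (by fun_prop) (by fun_prop)]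
    rfl

lemma memLp_gaussianMatrix_entry {m n : ℕ} (i : Fin m) (l : Fin n) (p : ℕ) :
    MemLp (fun Q : Fin m → Fin n → ℝ => Q i l) p (gaussianMatrix m n) :=
  memLp_pi_eval (memLp_pi_eval (memLp_id_gaussianReal' p (by simp)) l) i

lemma integral_gaussianMatrix_entry {m n : ℕ} (i : Fin m) (l : Fin n) {f : ℝ → ℝ}
    (hf : Measurable f) :
    ∫ Q, f (Q i l) ∂(gaussianMatrix m n) = ∫ x, f x ∂(gaussianReal 0 1) := by
  rw [integral_pi_eval (γ := Measure.pi fun _ : Fin n => gaussianReal 0 1)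
    (f := fun x => f (x l)) (by fun_prop) i]
  exact integral_pi_eval (by fun_prop) l

lemma integral_sq_gaussianReal : ∫ x, x ^ 2 ∂(gaussianReal 0 1) = 1 := by
  have h := variance_fun_id_gaussianReal (μ := 0) (v := 1)
  rw [variance_eq_integral (by fun_prop)] at h
  simpa using h

lemma memLp_mul_of_forall {Ω : Type*} [MeasurableSpace Ω] {μ : Measure Ω} {X Y : Ω → ℝ}
    (hX : ∀ p : ℕ, MemLp X p μ) (hY : ∀ p : ℕ, MemLp Y p μ) (p : ℕ) :
    MemLp (fun ω => X ω * Y ω) p μ := by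
  have : ENNReal.HolderTriple ((2 * p : ℕ) : ENNReal) ((2 * p : ℕ) : ENNReal) (p : ENNReal) :=
    ⟨by
      push_cast
      rw [ENNReal.mul_inv (by simp) (by simp), ← add_mul, ENNReal.inv_two_add_inv_two, one_mul]⟩
  exact (hY (2 * p)).mul' (hX (2 * p))

/-- A bound for the `2 k`-th moment of `x y - c`, with `x`, `y` standard Gaussian and
`|c| ≤ 1`. -/
noncomputable def gaussianProdBound (k : ℕ) : ℝ :=
  2 ^ (2 * k - 1) * (2 * ∫ x, x ^ (4 * k) ∂(gaussianReal 0 1) + 1)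

lemma gaussianProdBound_nonneg (k : ℕ) : 0 ≤ gaussianProdBound k := by
  have : 0 ≤ ∫ x, x ^ (4 * k) ∂(gaussianReal 0 1) :=
    integral_nonneg fun x => Even.pow_nonneg (by simp [show 4 * k = 2 * (2 * k) by ring]) x
  unfold gaussianProdBound
  positivity

lemma mul_sub_pow_le (x y c : ℝ) (hc : |c| ≤ 1) (k : ℕ) :
    (x * y - c) ^ (2 * k) ≤ 2 ^ (2 * k - 1) * (x ^ (4 * k) + y ^ (4 * k) + 1) := by
  have h1 : |x * y - c| ≤ |x * y| + 1 := (abs_sub _ _).trans (by linarith)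
  have h2 := add_pow_le (abs_nonneg (x * y)) zero_le_one (2 * k)
  have h3 : |x * y| ^ (2 * k) ≤ x ^ (4 * k) + y ^ (4 * k) := by
    rw [Even.pow_abs (by simp), mul_pow, show 4 * k = 2 * k * 2 by ring, pow_mul _ _ 2,
      pow_mul _ _ 2]
    nlinarith [sq_nonneg (x ^ (2 * k) - y ^ (2 * k)), sq_nonneg (x ^ (2 * k)),
      sq_nonneg (y ^ (2 * k))]
  calc (x * y - c) ^ (2 * k) = |x * y - c| ^ (2 * k) := (Even.pow_abs (by simp) _).symm
    _ ≤ (|x * y| + 1) ^ (2 * k) := by gcongr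
    _ ≤ _ := h2
    _ ≤ _ := by
      rw [one_pow]
      gcongr

/-- Concentration of the inner products of the rows of a Gaussian matrix. -/
lemma measure_gaussianMatrix_inner_ge_le {d : ℕ} (hd : 0 < d) {η : ℝ} {p : ℕ} (hp : 2 ≤ p * η)
    (i k : Fin d) :
    gaussianMatrix d d {Q | (d : ℝ) ^ (1 / 2 + η) ≤
        |∑ l, (Q i l * Q k l - if i = k then 1 else 0)|} ≤
      ENNReal.ofReal (momentConst gaussianProdBound p * ((d : ℝ) ^ 4)⁻¹) := by
  set c : ℝ := if i = k then 1 else 0 with hc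
  have hc1 : |c| ≤ 1 := by rw [hc]; split_ifs <;> simp
  have hfam := iIndepFun_gaussianMatrix d d
  have hmem : ∀ l (p : ℕ), MemLp (fun Q : Fin d → Fin d → ℝ => Q i l * Q k l) p
      (gaussianMatrix d d) := fun l =>
    memLp_mul_of_forall (memLp_gaussianMatrix_entry i l) (memLp_gaussianMatrix_entry k l)
  refine measure_abs_sum_ge_le (X := fun l (Q : Fin d → Fin d → ℝ) => Q i l * Q k l - c)
    gaussianProdBound_nonneg ?_ ?_ ?_ ?_ hp hd
  · exact fun l q => (hmem l q).sub (memLp_const c)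
  · intro l
    have hint : Integrable (fun Q : Fin d → Fin d → ℝ => Q i l * Q k l) (gaussianMatrix d d) :=
      memLp_one_iff_integrable.1 (by simpa using hmem l 1)
    rw [integral_sub hint (integrable_const c)]
    simp only [integral_const, probReal_univ, smul_eq_mul, one_mul]
    by_cases hik : i = k
    · subst hik
      have := integral_gaussianMatrix_entry (m := d) i l (f := fun x => x ^ 2) (by fun_prop)
      rw [integral_sq_gaussianReal] at this
      simp only [← sq, this, hc, if_true, sub_self]
    · have hI : IndepFun (fun Q : Fin d → Fin d → ℝ => Q i l) (fun Q => Q k l)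
          (gaussianMatrix d d) :=
        hfam.indepFun (i := (i, l)) (j := (k, l)) (by simp [hik])
      rw [hI.integral_fun_mul_eq_mul_integral (Measurable.aestronglyMeasurable (by fun_prop))
          (Measurable.aestronglyMeasurable (by fun_prop)),
        integral_gaussianMatrix_entry i l (f := fun x => x) measurable_id]
      simp [hc, hik]
  · intro l q
    have hi := integrable_pow_of_memLp (memLp_gaussianMatrix_entry (m := d) i l) (4 * q)
    have hk := integrable_pow_of_memLp (memLp_gaussianMatrix_entry (m := d) k l) (4 * q)
    have hX := integrable_pow_of_memLp (fun q => (hmem l q).sub (memLp_const c)) (2 * q)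
    calc ∫ Q, (Q i l * Q k l - c) ^ (2 * q) ∂(gaussianMatrix d d)
        ≤ ∫ Q, 2 ^ (2 * q - 1) * (Q i l ^ (4 * q) + Q k l ^ (4 * q) + 1)
          ∂(gaussianMatrix d d) :=
          integral_mono hX (((hi.add hk).add (integrable_const 1)).const_mul _)
            fun Q => mul_sub_pow_le _ _ _ hc1 q
      _ = gaussianProdBound q := by
          rw [integral_const_mul, integral_add (by fun_prop) (by fun_prop),
            integral_add (by fun_prop) (by fun_prop),
            integral_gaussianMatrix_entry i l (f := fun x => x ^ (4 * q)) (by fun_prop),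
            integral_gaussianMatrix_entry k l (f := fun x => x ^ (4 * q)) (by fun_prop)]
          simp [gaussianProdBound]
          ring
  · intro s a ha
    have hdisj : Disjoint (Finset.univ ×ˢ s : Finset (Fin d × Fin d)) (Finset.univ ×ˢ {a}) := by
      rw [Finset.disjoint_left]
      rintro ⟨u, v⟩ h1 h2
      simp only [Finset.mem_product, Finset.mem_univ, true_and, Finset.mem_singleton] at h1 h2
      exact ha (h2 ▸ h1)
    have hI := hfam.indepFun_finset _ _ hdisj (fun q => by fun_prop)
    let φ : (((Finset.univ ×ˢ s : Finset (Fin d × Fin d)) : Type) → ℝ) → ℝ :=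
      fun z => ∑ l : s, (z ⟨(i, l), by simp⟩ * z ⟨(k, l), by simp⟩ - c)
    let ψ : (((Finset.univ ×ˢ {a} : Finset (Fin d × Fin d)) : Type) → ℝ) → ℝ :=
      fun z => z ⟨(i, a), by simp⟩ * z ⟨(k, a), by simp⟩ - c
    have hI' := hI.comp (φ := φ) (ψ := ψ) (by fun_prop) (by fun_prop)
    convert! hI' using 1
    ext Q
    exact (Finset.sum_coe_sort s fun l => Q i l * Q k l - c).symm

lemma integral_exp_dot {d : ℕ} (a : Fin d → ℝ) :
    ∫ x : Fin d → ℝ, exp (∑ l, a l * x l) ∂(Measure.pi fun _ => gaussianReal 0 1)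
      = exp ((∑ l, a l ^ 2) / 2) := by
  simp only [Real.exp_sum]
  rw [integral_fintype_prod_eq_prod (fun l x => exp (a l * x))]
  rw [Finset.sum_div, Real.exp_sum]
  refine Finset.prod_congr rfl fun l _ => ?_
  have := congrFun (mgf_fun_id_gaussianReal (μ := 0) (v := 1)) (a l)
  simpa [mgf] using this

lemma integrable_exp_dot {d : ℕ} (a : Fin d → ℝ) :
    Integrable (fun x : Fin d → ℝ => exp (∑ l, a l * x l))
      (Measure.pi fun _ => gaussianReal 0 1) := by
  simp only [Real.exp_sum]
  exact Integrable.fintype_prod (f := fun l x => exp (a l * x))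
    fun l => integrable_exp_mul_gaussianReal (a l)

lemma exp_dot_pow {d : ℕ} (a x : Fin d → ℝ) (k : ℕ) :
    exp (∑ l, a l * x l) ^ k = exp (∑ l, (k * a l) * x l) := by
  rw [← Real.exp_nat_mul, Finset.mul_sum]
  simp only [mul_assoc]

lemma memLp_exp_dot {d : ℕ} (a : Fin d → ℝ) (p : ℕ) :
    MemLp (fun x : Fin d → ℝ => exp (∑ l, a l * x l)) p
      (Measure.pi fun _ => gaussianReal 0 1) := by
  rcases Nat.eq_zero_or_pos p with rfl | hp
  · simpa using (integrable_exp_dot a).1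
  rw [← integrable_norm_rpow_iff (integrable_exp_dot a).1 (by simpa using hp.ne') (by simp)]
  simp only [ENNReal.toReal_natCast, Real.norm_eq_abs, Real.abs_exp, Real.rpow_natCast,
    exp_dot_pow]
  exact integrable_exp_dot _

/-- A bound for the `2 k`-th central moment of a log-normal variable whose logarithm is centred
with variance at most `V`. -/
noncomputable def lognormalBound (V : ℝ) (k : ℕ) : ℝ := exp (2 * k ^ 2 * V) + exp (k * V)

lemma lognormalBound_nonneg (V : ℝ) (k : ℕ) : 0 ≤ lognormalBound V k := by
  unfold lognormalBound
  positivity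

/-- Concentration of sums of exponentials of linear functionals of the rows of a Gaussian
matrix. -/
lemma measure_sum_exp_ge_le {n d : ℕ} (hn : 0 < n) {η : ℝ} {p : ℕ} (hp : 2 ≤ p * η) {V : ℝ}
    (a : Fin d → ℝ) (ha : ∑ l, a l ^ 2 ≤ V) :
    gaussianMatrix n d {K | (n : ℝ) ^ (1 / 2 + η) ≤
        |∑ j, (exp (∑ l, a l * K j l) - exp ((∑ l, a l ^ 2) / 2))|} ≤
      ENNReal.ofReal (momentConst (lognormalBound V) p * ((n : ℝ) ^ 4)⁻¹) := by
  set m : ℝ := exp ((∑ l, a l ^ 2) / 2) with hm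
  have hmem : ∀ q : ℕ, MemLp (fun x : Fin d → ℝ => exp (∑ l, a l * x l) - m) q
      (Measure.pi fun _ => gaussianReal 0 1) :=
    fun q => (memLp_exp_dot a q).sub (memLp_const m)
  refine measure_abs_sum_ge_le
    (X := fun j (K : Fin n → Fin d → ℝ) => exp (∑ l, a l * K j l) - m)
    (lognormalBound_nonneg V) ?_ ?_ ?_ ?_ hp hn
  · exact fun j q => memLp_pi_eval (hmem q) j
  · intro j
    rw [integral_pi_eval (f := fun x : Fin d → ℝ => exp (∑ l, a l * x l) - m) (by fun_prop) j,
      integral_sub (integrable_exp_dot a) (integrable_const m), integral_exp_dot]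
    simp [hm]
  · intro j k
    rw [integral_pi_eval (f := fun x : Fin d → ℝ => (exp (∑ l, a l * x l) - m) ^ (2 * k))
      (by fun_prop) j]
    calc ∫ x, (exp (∑ l, a l * x l) - m) ^ (2 * k) ∂(Measure.pi fun _ => gaussianReal 0 1)
        ≤ ∫ x, (exp (∑ l, ((2 * k : ℕ) * a l) * x l) + m ^ (2 * k))
          ∂(Measure.pi fun _ => gaussianReal 0 1) := by
          refine integral_mono (integrable_pow_of_memLp hmem _)
            ((integrable_exp_dot _).add (integrable_const _)) fun x => ?_
          simp only [← exp_dot_pow]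
          have h1 := exp_pos (∑ l, a l * x l)
          have h2 : 0 < m := exp_pos _
          rw [← Even.pow_abs (by simp)]
          rcases le_total m (exp (∑ l, a l * x l)) with h | h
          · have : |exp (∑ l, a l * x l) - m| ≤ exp (∑ l, a l * x l) := by
              rw [abs_of_nonneg] <;> linarith
            calc _ ≤ exp (∑ l, a l * x l) ^ (2 * k) := by gcongr
              _ ≤ _ := le_add_of_nonneg_right (by positivity)
          · have : |exp (∑ l, a l * x l) - m| ≤ m := by
              rw [abs_of_nonpos] <;> linarith
            calc _ ≤ m ^ (2 * k) := by gcongr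
              _ ≤ _ := le_add_of_nonneg_left (by positivity)
      _ = exp (2 * k ^ 2 * ∑ l, a l ^ 2) + exp (k * ∑ l, a l ^ 2) := by
          rw [integral_add (integrable_exp_dot _) (integrable_const _), integral_exp_dot]
          simp only [mul_pow, ← Finset.mul_sum, integral_const, probReal_univ, smul_eq_mul,
            one_mul, hm, ← Real.exp_nat_mul]
          congr 2 <;> push_cast <;> ring
      _ ≤ lognormalBound V k := by
          unfold lognormalBound
          gcongr
  · intro s j hj
    have hfam := iIndepFun_pi (μ := fun _ : Fin n => Measure.pi fun _ : Fin d => gaussianReal 0 1)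
      (X := fun _ x => exp (∑ l, a l * x l) - m) (fun _ => Measurable.aemeasurable (by fun_prop))
    have h := hfam.indepFun_finsetSum_of_notMem (fun _ => by fun_prop) hj
    convert! h using 1
    ext K
    simp

end Gaussian

section GoodEvents

lemma prod_gaussianMatrix_le {d : ℕ} (hd : 0 < d) {η : ℝ} {p : ℕ} (hp : 2 ≤ p * η) (V : ℝ)
    {a : (Fin d → Fin d → ℝ) → Fin d → ℝ} (ha : Measurable a) :
    ((gaussianMatrix d d).prod (gaussianMatrix d d)) {q | ∑ l, a q.1 l ^ 2 ≤ V ∧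
        (d : ℝ) ^ (1 / 2 + η) ≤
          |∑ j, (exp (∑ l, a q.1 l * q.2 j l) - exp ((∑ l, a q.1 l ^ 2) / 2))|} ≤
      ENNReal.ofReal (momentConst (lognormalBound V) p * ((d : ℝ) ^ 4)⁻¹) := by
  have ha' : ∀ l, Measurable fun Q => a Q l := fun l => (measurable_pi_apply l).comp ha
  have hm : MeasurableSet {q : (Fin d → Fin d → ℝ) × (Fin d → Fin d → ℝ) |
      ∑ l, a q.1 l ^ 2 ≤ V ∧ (d : ℝ) ^ (1 / 2 + η) ≤
        |∑ j, (exp (∑ l, a q.1 l * q.2 j l) - exp ((∑ l, a q.1 l ^ 2) / 2))|} := by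
    have ha₁ : ∀ l, Measurable fun q : (Fin d → Fin d → ℝ) × (Fin d → Fin d → ℝ) => a q.1 l :=
      fun l => (ha' l).comp measurable_fst
    have hK : ∀ j l, Measurable fun q : (Fin d → Fin d → ℝ) × (Fin d → Fin d → ℝ) => q.2 j l :=
      fun j l => by fun_prop
    have hs : Measurable fun q : (Fin d → Fin d → ℝ) × (Fin d → Fin d → ℝ) =>
        ∑ l, a q.1 l ^ 2 := Finset.measurable_sum _ fun l _ => (ha₁ l).pow_const 2
    have he : Measurable fun q : (Fin d → Fin d → ℝ) × (Fin d → Fin d → ℝ) =>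
        ∑ j, (exp (∑ l, a q.1 l * q.2 j l) - exp ((∑ l, a q.1 l ^ 2) / 2)) :=
      Finset.measurable_sum _ fun j _ => ((Finset.measurable_sum _ fun l _ =>
        (ha₁ l).mul (hK j l)).exp).sub (hs.div_const 2).exp
    exact (measurableSet_le hs measurable_const).inter
      (measurableSet_le measurable_const he.abs)
  rw [Measure.prod_apply hm]
  calc _ ≤ ∫⁻ _, ENNReal.ofReal (momentConst (lognormalBound V) p * ((d : ℝ) ^ 4)⁻¹)
        ∂(gaussianMatrix d d) := by
        refine lintegral_mono fun Q => ?_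
        by_cases hQ : ∑ l, a Q l ^ 2 ≤ V
        · refine (measure_mono ?_).trans (measure_sum_exp_ge_le hd hp (a Q) hQ)
          exact fun K hK => hK.2
        · refine (measure_mono (t := ∅) ?_).trans (by simp)
          exact fun K hK => hQ hK.1
    _ = _ := by simp

/-- A Borel–Cantelli argument for a quadratic number of rare events in each dimension. -/
lemma ae_eventually_forall_notMem {Ω : Type*} [MeasurableSpace Ω] {P : Measure Ω}
    [IsProbabilityMeasure P] {W : (d : ℕ) → Ω → (Fin d → Fin d → ℝ) × (Fin d → Fin d → ℝ)}
    (hW : ∀ d, Measure.map (W d) P = (gaussianMatrix d d).prod (gaussianMatrix d d))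
    (E : (d : ℕ) → Fin d → Fin d → Set ((Fin d → Fin d → ℝ) × (Fin d → Fin d → ℝ))) {C : ℝ}
    (hE : ∀ d, 0 < d → ∀ i k,
      ((gaussianMatrix d d).prod (gaussianMatrix d d)) (E d i k) ≤
        ENNReal.ofReal (C * ((d : ℝ) ^ 4)⁻¹)) :
    ∀ᵐ ω ∂P, ∀ᶠ d in atTop, ∀ i k, W d ω ∉ E d i k := by
  have hbound : ∀ d, P {ω | ∃ i k, W d ω ∈ E d i k} ≤ ENNReal.ofReal (C * ((d : ℝ) ^ 2)⁻¹) := by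
    intro d
    have hae : AEMeasurable (W d) P := by
      refine AEMeasurable.of_map_ne_zero ?_
      rw [hW]
      exact IsProbabilityMeasure.ne_zero _
    have hone : ∀ i k, P {ω | W d ω ∈ E d i k} ≤ ENNReal.ofReal (C * ((d : ℝ) ^ 4)⁻¹) :=
      fun i k => (Measure.le_map_apply hae _).trans (by rw [hW]; exact hE d i.pos i k)
    have hset : {ω | ∃ i k, W d ω ∈ E d i k} = ⋃ q : Fin d × Fin d, {ω | W d ω ∈ E d q.1 q.2} := by
      ext ω
      simp
    rw [hset]
    refine (measure_iUnion_fintype_le P _).trans ?_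
    refine (Finset.sum_le_sum fun q _ => hone q.1 q.2).trans ?_
    rw [Finset.sum_const, nsmul_eq_mul, ← ENNReal.ofReal_natCast,
      ← ENNReal.ofReal_mul (by positivity)]
    refine ENNReal.ofReal_le_ofReal (le_of_eq ?_)
    rw [Finset.card_univ, Fintype.card_prod, Fintype.card_fin]
    rcases Nat.eq_zero_or_pos d with rfl | hd
    · simp
    · push_cast
      field_simp
  have hsum : ∑' d, P {ω | ∃ i k, W d ω ∈ E d i k} ≠ ⊤ := by
    refine ne_top_of_le_ne_top ?_ (ENNReal.tsum_le_tsum hbound)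
    exact Summable.tsum_ofReal_ne_top
      ((Real.summable_nat_pow_inv.2 one_lt_two).mul_left C)
  filter_upwards [ae_eventually_notMem hsum] with ω hω
  filter_upwards [hω] with d hd i k h
  exact hd ⟨i, k, h⟩

end GoodEvents

section Deterministic

lemma abs_exp_add_sub_exp_le (c : ℝ) {y t : ℝ} (hy : |y| ≤ t) (ht : t ≤ 1) :
    |exp (c + y) - exp c| ≤ 2 * exp c * t := by
  have h1 : exp (c + y) - exp c = exp c * (exp y - 1) := by rw [exp_add]; ring
  rw [h1, abs_mul, abs_exp]
  have h2 := Real.abs_exp_sub_one_le (hy.trans ht)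
  nlinarith [exp_pos c]

/-- Comparison of the singular values of `√d A_d` and `Y_d` from the row sums of `Y_d`. -/
lemma abs_sVal_sub_le_of_diagonal {d : ℕ} {M N : Matrix (Fin d) (Fin d) ℝ} {u : Fin d → ℝ}
    {t : ℝ} (ht : t ≤ 1 / 2) (hu : ∀ i, |u i - 1| ≤ t) (hM : M = Matrix.diagonal u * N)
    (i : Fin d) : |sVal N i - sVal M i| ≤ 2 * t * sVal M i := by
  have ht0 : 0 ≤ t := (abs_nonneg _).trans (hu i)
  have hu' : ∀ i, 1 - t ≤ u i ∧ u i ≤ 1 + t := fun i => by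
    have := abs_le.1 (hu i)
    constructor <;> linarith
  have hN : N = Matrix.diagonal (fun i => (u i)⁻¹) * M := by
    rw [hM, ← Matrix.mul_assoc, Matrix.diagonal_mul_diagonal]
    have : (fun i => (u i)⁻¹ * u i) = fun _ => 1 := by
      ext i
      have := (hu' i).1
      exact inv_mul_cancel₀ (by linarith)
    rw [this, Matrix.diagonal_one, Matrix.one_mul]
  have h1 : sVal M i ≤ (1 + t) * sVal N i := by
    conv_lhs => rw [hM]
    refine sVal_diagonal_mul_le N u (by linarith) (fun j => ?_) i
    have := hu' j
    rw [abs_of_nonneg] <;> linarith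
  have h2 : sVal N i ≤ (1 + 2 * t) * sVal M i := by
    conv_lhs => rw [hN]
    refine sVal_diagonal_mul_le M _ (by linarith) (fun j => ?_) i
    have := hu' j
    have hpos : 0 < u j := by linarith
    rw [abs_of_pos (inv_pos.2 hpos), inv_le_iff_one_le_mul₀ hpos]
    nlinarith
  have h3 := sVal_nonneg M i
  have h4 := sVal_nonneg N i
  rw [abs_le]
  constructor
  · by_contra! h
    nlinarith [mul_nonneg ht0 h3, mul_nonneg ht0 h4]
  · linarith

/-- The rows of the query matrix have almost orthonormal scalar products. -/
def NearOrthonormalRows {d : ℕ} (Q : Fin d → Fin d → ℝ) (τ : ℝ) : Prop :=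
  ∀ i k, |∑ l, (Q i l * Q k l - if i = k then 1 else 0)| ≤ d * τ

/-- The sum over the rows of `K` of `exp ⟪a, K_j⟫` is close to its Gaussian expectation, provided
the variance of the exponent is controlled. -/
def ExpSumConcentrated {d : ℕ} (a : Fin d → ℝ) (K : Fin d → Fin d → ℝ) (V τ : ℝ) : Prop :=
  ∑ l, a l ^ 2 ≤ V →
    |∑ j, (exp (∑ l, a l * K j l) - exp ((∑ l, a l ^ 2) / 2))| ≤ d * τ

lemma sum_sq_scaled_row_le {d : ℕ} {Q : Fin d → Fin d → ℝ} {τ : ℝ}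
    (hd : 0 < d) (β : ℝ) (hQ : NearOrthonormalRows Q τ) (i : Fin d) :
    |∑ l, (β / √d * Q i l) ^ 2 - β ^ 2| ≤ β ^ 2 * τ := by
  have hd' : (0 : ℝ) < d := by exact_mod_cast hd
  have h := hQ i i
  simp only [if_true, Finset.sum_sub_distrib, Finset.sum_const, Finset.card_univ,
    Fintype.card_fin, nsmul_eq_mul, mul_one] at h
  have e : ∑ l, (β / √d * Q i l) ^ 2 - β ^ 2 = β ^ 2 / d * (∑ l, Q i l * Q i l - d) := by
    simp only [mul_pow, div_pow, Real.sq_sqrt hd'.le, ← Finset.mul_sum, ← sq]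
    field_simp
  rw [e, abs_mul, abs_of_nonneg (by positivity)]
  calc _ ≤ β ^ 2 / d * (d * τ) := by gcongr
    _ = _ := by field_simp

lemma sum_sq_scaled_rows_add_le {d : ℕ} {Q : Fin d → Fin d → ℝ} {τ : ℝ}
    (hd : 0 < d) (β : ℝ) (hQ : NearOrthonormalRows Q τ) (i k : Fin d) :
    |∑ l, (β / √d * (Q i l + Q k l)) ^ 2 - 2 * (β ^ 2 + if i = k then β ^ 2 else 0)|
      ≤ 4 * β ^ 2 * τ := by
  have hd' : (0 : ℝ) < d := by exact_mod_cast hd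
  have h1 := hQ i i
  have h2 := hQ k k
  have h3 := hQ i k
  have e : ∑ l, (β / √d * (Q i l + Q k l)) ^ 2 - 2 * (β ^ 2 + if i = k then β ^ 2 else 0)
      = β ^ 2 / d * (∑ l, (Q i l * Q i l - if i = i then 1 else 0)
        + ∑ l, (Q k l * Q k l - if k = k then 1 else 0)
        + 2 * ∑ l, (Q i l * Q k l - if i = k then 1 else 0)) := by
    simp only [if_true, Finset.sum_sub_distrib, Finset.sum_const, Finset.card_univ,
      Fintype.card_fin, nsmul_eq_mul, mul_pow, div_pow, Real.sq_sqrt hd'.le, ← Finset.mul_sum,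
      add_sq, Finset.sum_add_distrib, ← sq, mul_assoc]
    split_ifs <;> field_simp <;> ring
  rw [e, abs_mul, abs_of_nonneg (by positivity)]
  calc _ ≤ β ^ 2 / d * (d * τ + d * τ + 2 * (d * τ)) := by
        gcongr
        refine (abs_add_three _ _ _).trans ?_
        rw [abs_mul, abs_two]
        gcongr
    _ = _ := by field_simp; ring


lemma ExpSumConcentrated.abs_div_sub_one_le {d : ℕ} {a : Fin d → ℝ} {K : Fin d → Fin d → ℝ}
    {V τ c t : ℝ} (h : ExpSumConcentrated a K V τ) (hd : 0 < d) (hV : ∑ l, a l ^ 2 ≤ V)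
    (hc : 0 ≤ c) (hac : |∑ l, a l ^ 2 - 2 * c| ≤ 2 * t) (ht : t ≤ 1) :
    |(∑ j, exp (∑ l, a l * K j l)) / (d * exp c) - 1| ≤ τ + 2 * t := by
  have hd' : (0 : ℝ) < d := by exact_mod_cast hd
  have h1 := h hV
  have hτ : 0 ≤ τ := nonneg_of_mul_nonneg_right ((abs_nonneg _).trans h1) hd'
  have hce : 1 ≤ exp c := one_le_exp hc
  have h2 : |exp ((∑ l, a l ^ 2) / 2) - exp c| ≤ 2 * exp c * t := by
    have := abs_exp_add_sub_exp_le c (y := (∑ l, a l ^ 2) / 2 - c) (t := t) ?_ ht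
    · simpa using this
    · have e : (∑ l, a l ^ 2) / 2 - c = (∑ l, a l ^ 2 - 2 * c) / 2 := by ring
      rw [e, abs_div, abs_two]
      linarith
  simp only [Finset.sum_sub_distrib, Finset.sum_const, Finset.card_univ, Fintype.card_fin,
    nsmul_eq_mul] at h1
  set s := ∑ j, exp (∑ l, a l * K j l)
  set g := exp ((∑ l, a l ^ 2) / 2)
  have hpos : 0 < d * exp c := by positivity
  have e : s / (d * exp c) - 1 = (s - d * g + d * (g - exp c)) / (d * exp c) := by
    field_simp
    ring
  rw [e, abs_div, abs_of_pos hpos, div_le_iff₀ hpos]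
  calc _ ≤ |s - d * g| + |d * (g - exp c)| := abs_add_le _ _
    _ ≤ d * τ + d * (2 * exp c * t) := by
      rw [abs_mul, abs_of_pos hd']
      gcongr
    _ ≤ d * (exp c * τ) + d * (2 * exp c * t) := by
      gcongr
      exact le_mul_of_one_le_left hτ hce
    _ = _ := by ring

lemma mul_scoreS_apply {Ω : Type*} (β : ℝ) (WQ WK : (d : ℕ) → Ω → Fin d → Fin d → ℝ)
    (d : ℕ) (ω : Ω) (i j : Fin d) :
    β * scoreS WQ WK d ω i j = ∑ l, β / √d * WQ d ω i l * WK d ω j l := by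
  simp only [scoreS, Matrix.smul_apply, Matrix.mul_apply, Matrix.transpose_apply,
    Matrix.of_apply, smul_eq_mul, Finset.mul_sum]
  refine Finset.sum_congr rfl fun l _ => ?_
  ring

lemma Ymat_eq_diagonal_mul {Ω : Type*} (β : ℝ) (WQ WK : (d : ℕ) → Ω → Fin d → Fin d → ℝ)
    (d : ℕ) (ω : Ω) :
    Ymat β WQ WK d ω = Matrix.diagonal (fun i =>
      (∑ j, exp (β * scoreS WQ WK d ω i j)) / (d * exp (β ^ 2 / 2))) *
        (√d • attn β WQ WK d ω) := by
  ext i j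
  have hd' : (0 : ℝ) < d := by exact_mod_cast i.pos
  have hZ : 0 < ∑ k, exp (β * scoreS WQ WK d ω i k) :=
    Finset.sum_pos (fun k _ => exp_pos _) ⟨i, Finset.mem_univ i⟩
  simp only [Matrix.diagonal_mul, Matrix.smul_apply, Ymat, attn, Matrix.of_apply, smul_eq_mul]
  have hs0 : 0 < √(d : ℝ) := Real.sqrt_pos.2 hd'
  field_simp
  rw [Real.sq_sqrt hd'.le]

lemma Ymat_mul_transpose_apply {Ω : Type*} (β : ℝ) (WQ WK : (d : ℕ) → Ω → Fin d → Fin d → ℝ)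
    (d : ℕ) (ω : Ω) (i k : Fin d) :
    (Ymat β WQ WK d ω * (Ymat β WQ WK d ω)ᵀ) i k =
      (∑ j, exp (∑ l, β / √d * (WQ d ω i l + WQ d ω k l) * WK d ω j l)) /
        (d * exp (β ^ 2)) := by
  have hd' : (0 : ℝ) < d := by exact_mod_cast i.pos
  simp only [Matrix.mul_apply, Matrix.transpose_apply, Ymat, Matrix.of_apply, Finset.sum_div]
  refine Finset.sum_congr rfl fun j _ => ?_
  rw [div_mul_div_comm, ← exp_add, mul_scoreS_apply, mul_scoreS_apply, ← Finset.sum_add_distrib]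
  congr 1
  · congr 1
    refine Finset.sum_congr rfl fun l _ => ?_
    ring
  · rw [mul_mul_mul_comm, Real.mul_self_sqrt hd'.le, ← exp_add, add_halves, mul_comm]

/-- The deterministic comparison of the two spectra on the event where the rows of `W^Q_d` are
almost orthonormal and the relevant exponential sums concentrate. -/
lemma exists_abs_sVal_attn_sub_le {Ω : Type*} {β τ : ℝ}
    {WQ WK : (d : ℕ) → Ω → Fin d → Fin d → ℝ} {d : ℕ} {ω : Ω} (hd : 0 < d) (hτ0 : 0 ≤ τ)
    (hτ : (2 * β ^ 2 + 2) * τ ≤ 1 / 2) (hQ : NearOrthonormalRows (WQ d ω) τ)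
    (h1 : ∀ i, ExpSumConcentrated (fun l => β / √d * WQ d ω i l) (WK d ω) (6 * β ^ 2) τ)
    (h2 : ∀ i k, ExpSumConcentrated (fun l => β / √d * (WQ d ω i l + WQ d ω k l)) (WK d ω)
      (6 * β ^ 2) τ) :
    ∃ e : ℝ, |e| ≤ 2 * ((β ^ 2 + 1) * τ) ∧
      ⨆ i : Fin d, |sVal (√d • attn β WQ WK d ω) i - (1 + e) * sVal (Ymat β WQ WK d ω) i| ≤
        4 * ((β ^ 2 + 1) * τ) *
          √(exp (β ^ 2) * (1 + 4 * β ^ 2) * τ * d + exp (β ^ 2)) := by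
  set M := Ymat β WQ WK d ω with hM
  set N := √d • attn β WQ WK d ω with hN
  have hβ2 := sq_nonneg β
  have hβτ : 0 ≤ β ^ 2 * τ := by positivity
  have hτ4 : τ ≤ 1 / 4 := by nlinarith
  have hdiff : ∀ i, |sVal N i - sVal M i| ≤ 2 * ((β ^ 2 + 1) * τ) * sVal M i := by
    refine abs_sVal_sub_le_of_diagonal (by nlinarith) (fun i => ?_)
      (Ymat_eq_diagonal_mul β WQ WK d ω)
    have hs := sum_sq_scaled_row_le hd β hQ i
    have := (h1 i).abs_div_sub_one_le hd (c := β ^ 2 / 2) (t := β ^ 2 * τ / 2)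
      (by have := (abs_le.1 hs).2; nlinarith) (by positivity)
      (by convert hs using 1 <;> ring_nf) (by nlinarith)
    simp only [mul_scoreS_apply]
    exact this.trans (le_of_eq (by ring))
  have hentry : ∀ i k, |(M * Mᵀ) i k - 1| ≤
      exp (β ^ 2) * (1 + 4 * β ^ 2) * τ + if i = k then exp (β ^ 2) else 0 := by
    intro i k
    have hE : 1 ≤ exp (β ^ 2) := one_le_exp hβ2
    have hs := sum_sq_scaled_rows_add_le hd β hQ i k
    have hr := (h2 i k).abs_div_sub_one_le hd (c := β ^ 2 + if i = k then β ^ 2 else 0)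
      (t := 2 * β ^ 2 * τ)
      (by have := (abs_le.1 hs).2; split_ifs at this <;> nlinarith)
      (by split_ifs <;> positivity) (by convert hs using 1; ring) (by nlinarith)
    rw [hM, Ymat_mul_transpose_apply]
    set s := ∑ j, exp (∑ l, β / √d * (WQ d ω i l + WQ d ω k l) * WK d ω j l)
    have hnn : 0 ≤ (1 + 4 * β ^ 2) * τ := by positivity
    split_ifs at hr ⊢ with hik
    · have e : s / (d * exp (β ^ 2)) - 1 =
          exp (β ^ 2) * (s / (d * exp (β ^ 2 + β ^ 2)) - 1) + (exp (β ^ 2) - 1) := by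
        rw [exp_add]
        field_simp
        ring
      rw [e]
      refine (abs_add_le _ _).trans ?_
      rw [abs_mul, abs_exp, abs_of_nonneg (sub_nonneg.2 hE), mul_assoc]
      refine add_le_add ?_ (by linarith)
      refine mul_le_mul_of_nonneg_left (hr.trans (le_of_eq ?_)) (exp_pos _).le
      ring
    · rw [add_zero] at hr ⊢
      refine hr.trans ?_
      nlinarith
  have hsmall : ∀ i : Fin d, 0 < i.1 →
      sVal M i ≤ √(exp (β ^ 2) * (1 + 4 * β ^ 2) * τ * d + exp (β ^ 2)) := fun i hi =>
    Real.le_sqrt_of_sq_le (sVal_sq_le_of_entrywise M hentry hi)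
  set R := √(exp (β ^ 2) * (1 + 4 * β ^ 2) * τ * d + exp (β ^ 2))
  have hR : 0 ≤ R := Real.sqrt_nonneg _
  have hT : 0 ≤ (β ^ 2 + 1) * τ := by positivity
  set T := (β ^ 2 + 1) * τ
  let i₀ : Fin d := ⟨0, hd⟩
  have he : |(sVal N i₀ - sVal M i₀) / sVal M i₀| ≤ 2 * T := by
    rw [abs_div, abs_of_nonneg (sVal_nonneg M i₀)]
    exact div_le_of_le_mul₀ (sVal_nonneg M i₀) (by positivity) (hdiff i₀)
  refine ⟨(sVal N i₀ - sVal M i₀) / sVal M i₀, he, Real.iSup_le (fun i => ?_) (by positivity)⟩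
  rcases Nat.eq_zero_or_pos i.1 with hi | hi
  · have hi' : i = i₀ := Fin.ext hi
    subst hi'
    refine le_trans (le_of_eq ?_) (by positivity : 0 ≤ 4 * T * R)
    rw [abs_eq_zero]
    rcases eq_or_ne (sVal M i₀) 0 with h0 | h0
    · have := hdiff i₀
      rw [h0, mul_zero, sub_zero, abs_nonpos_iff] at this
      rw [h0, this]
      ring
    · field_simp
      ring
  · set e := (sVal N i₀ - sVal M i₀) / sVal M i₀
    have hMi := sVal_nonneg M i
    calc |sVal N i - (1 + e) * sVal M i| = |(sVal N i - sVal M i) + -(e * sVal M i)| := by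
          congr 1
          ring
      _ ≤ 2 * T * sVal M i + 2 * T * sVal M i := by
          refine (abs_add_le _ _).trans (add_le_add (hdiff i) ?_)
          rw [abs_neg, abs_mul, abs_of_nonneg hMi]
          gcongr
      _ = 4 * T * sVal M i := by ring
      _ ≤ 4 * T * R := by
          have := hsmall i hi
          gcongr

end Deterministic

section Limits

lemma tendsto_natCast_rpow_of_neg {s : ℝ} (hs : s < 0) :
    Tendsto (fun d : ℕ => (d : ℝ) ^ s) atTop (nhds 0) := by
  have := (tendsto_rpow_neg_atTop (neg_pos.2 hs)).comp tendsto_natCast_atTop_atTop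
  simpa [Function.comp_def] using this

lemma natCast_mul_rpow {d : ℕ} (hd : 0 < d) (η : ℝ) :
    (d : ℝ) * (d : ℝ) ^ (-1 / 2 + η) = (d : ℝ) ^ (1 / 2 + η) := by
  have hd' : (0 : ℝ) < d := by exact_mod_cast hd
  nth_rw 1 [← rpow_one (d : ℝ)]
  rw [← rpow_add hd']
  ring_nf

lemma mul_sqrt_rpow_le {d : ℕ} (hd : 0 < d) {η c C T : ℝ} (hη : 0 ≤ η) (hc : 0 ≤ c) (hC : 0 ≤ C)
    (hT : 0 ≤ T) :
    4 * (T * (d : ℝ) ^ (-1 / 2 + η)) * √(c * (d : ℝ) ^ (-1 / 2 + η) * d + C) ≤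
      4 * T * √(c + C) * (d : ℝ) ^ (-1 / 4 + 3 / 2 * η) := by
  have hd' : (1 : ℝ) ≤ d := by exact_mod_cast hd
  have hd0 : (0 : ℝ) < d := by linarith
  have h1 : √(c * (d : ℝ) ^ (-1 / 2 + η) * d + C) ≤ √(c + C) * (d : ℝ) ^ (1 / 4 + η / 2) := by
    have e : (d : ℝ) ^ (1 / 4 + η / 2) = √((d : ℝ) ^ (1 / 2 + η)) := by
      rw [sqrt_eq_rpow, ← rpow_mul hd0.le]
      ring_nf
    rw [e, ← Real.sqrt_mul (by positivity)]
    refine Real.sqrt_le_sqrt ?_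
    rw [mul_assoc, mul_comm _ (d : ℝ), natCast_mul_rpow hd]
    have := one_le_rpow hd' (by positivity : 0 ≤ 1 / 2 + η)
    nlinarith
  calc _ ≤ 4 * (T * (d : ℝ) ^ (-1 / 2 + η)) * (√(c + C) * (d : ℝ) ^ (1 / 4 + η / 2)) := by gcongr
    _ = 4 * T * √(c + C) * ((d : ℝ) ^ (-1 / 2 + η) * (d : ℝ) ^ (1 / 4 + η / 2)) := by ring
    _ = _ := by
      rw [← rpow_add hd0]
      ring_nf

end Limits

/-- Fix `β > 0` and `δ ∈ (0, 1/2]`. Almost surely there is a sequence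
`(ε_d)` with `d^{1/2−δ} ε_d → 0` such that
`max_{1 ≤ i ≤ d} |s_i(√d·A_d) − (1+ε_d) s_i(Y_d)| → 0` as `d → ∞`. -/
theorem stmt1 {Ω : Type*} [MeasurableSpace Ω] (P : Measure Ω) [IsProbabilityMeasure P]
    (β δ : ℝ) (hβ : 0 < β) (hδ : 0 < δ) (hδ' : δ ≤ 1 / 2)
    (WQ WK : (d : ℕ) → Ω → Fin d → Fin d → ℝ)
    (hlaw : ∀ d : ℕ, Measure.map (fun ω => (WQ d ω, WK d ω)) P =
      (Measure.pi fun _ : Fin d => Measure.pi fun _ : Fin d => gaussianReal 0 1).prod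
        (Measure.pi fun _ : Fin d => Measure.pi fun _ : Fin d => gaussianReal 0 1)) :
    ∀ᵐ ω ∂P, ∃ ε : ℕ → ℝ,
      Tendsto (fun d : ℕ => (d : ℝ) ^ ((1 : ℝ) / 2 - δ) * ε d) atTop (nhds 0) ∧
      Tendsto (fun d : ℕ => ⨆ i : Fin d,
          |sVal (Real.sqrt d • attn β WQ WK d ω) i -
            (1 + ε d) * sVal (Ymat β WQ WK d ω) i|) atTop (nhds 0) := by
  obtain ⟨η, hη0, hηδ, hη8⟩ : ∃ η : ℝ, 0 < η ∧ η < δ ∧ η ≤ 1 / 8 :=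
    ⟨δ / 4, by linarith, by linarith, by linarith⟩
  obtain ⟨p, hp'⟩ := exists_nat_ge (2 / η)
  have hp : 2 ≤ p * η := (div_le_iff₀ hη0).1 hp'
  have hgood₁ := ae_eventually_forall_notMem hlaw (fun d i k =>
      {q | (d : ℝ) ^ (1 / 2 + η) ≤ |∑ l, (q.1 i l * q.1 k l - if i = k then 1 else 0)|})
    (C := momentConst gaussianProdBound p) fun d hd i k => by
      have h := measurePreserving_fst (μ := gaussianMatrix d d) (ν := gaussianMatrix d d)
      refine (Measure.le_map_apply h.aemeasurable
        {Q | (d : ℝ) ^ (1 / 2 + η) ≤ |∑ l, (Q i l * Q k l - if i = k then 1 else 0)|}).trans ?_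
      rw [h.map_eq]
      exact measure_gaussianMatrix_inner_ge_le hd hp i k
  have hgood₂ := ae_eventually_forall_notMem hlaw (fun d i _ =>
      {q | ∑ l, (β / √d * q.1 i l) ^ 2 ≤ 6 * β ^ 2 ∧ (d : ℝ) ^ (1 / 2 + η) ≤
        |∑ j, (exp (∑ l, β / √d * q.1 i l * q.2 j l)
          - exp ((∑ l, (β / √d * q.1 i l) ^ 2) / 2))|})
    fun d hd i k => prod_gaussianMatrix_le hd hp (6 * β ^ 2)
      (a := fun Q l => β / √d * Q i l) (by fun_prop)
  have hgood₃ := ae_eventually_forall_notMem hlaw (fun d i k =>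
      {q | ∑ l, (β / √d * (q.1 i l + q.1 k l)) ^ 2 ≤ 6 * β ^ 2 ∧ (d : ℝ) ^ (1 / 2 + η) ≤
        |∑ j, (exp (∑ l, β / √d * (q.1 i l + q.1 k l) * q.2 j l)
          - exp ((∑ l, (β / √d * (q.1 i l + q.1 k l)) ^ 2) / 2))|})
    fun d hd i k => prod_gaussianMatrix_le hd hp (6 * β ^ 2)
      (a := fun Q l => β / √d * (Q i l + Q k l)) (by fun_prop)
  filter_upwards [hgood₁, hgood₂, hgood₃] with ω hω₁ hω₂ hω₃
  have hτ0 : Tendsto (fun d : ℕ => (2 * β ^ 2 + 2) * (d : ℝ) ^ (-1 / 2 + η)) atTop (nhds 0) := by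
    simpa using (tendsto_natCast_rpow_of_neg
      (by linarith : -1 / 2 + η < 0)).const_mul (2 * β ^ 2 + 2)
  have key : ∀ᶠ d : ℕ in atTop, ∃ e : ℝ, |e| ≤ 2 * ((β ^ 2 + 1) * (d : ℝ) ^ (-1 / 2 + η)) ∧
      ⨆ i : Fin d, |sVal (√d • attn β WQ WK d ω) i - (1 + e) * sVal (Ymat β WQ WK d ω) i| ≤
        4 * (β ^ 2 + 1) * √(exp (β ^ 2) * (1 + 4 * β ^ 2) + exp (β ^ 2)) *
          (d : ℝ) ^ (-1 / 4 + 3 / 2 * η) := by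
    filter_upwards [hω₁, hω₂, hω₃, eventually_gt_atTop 0,
      hτ0.eventually (eventually_le_nhds (by norm_num : (0 : ℝ) < 1 / 2))]
      with d h₁ h₂ h₃ hd hτ
    obtain ⟨e, he, hsup⟩ := exists_abs_sVal_attn_sub_le (WQ := WQ) (WK := WK) (ω := ω) hd
      (by positivity) hτ
      (fun i k => by
        rw [natCast_mul_rpow hd]
        exact (not_le.1 (h₁ i k)).le)
      (fun i hV => by
        rw [natCast_mul_rpow hd]
        exact (not_le.1 fun h => h₂ i i ⟨hV, h⟩).le)
      (fun i k hV => by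
        rw [natCast_mul_rpow hd]
        exact (not_le.1 fun h => h₃ i k ⟨hV, h⟩).le)
    exact ⟨e, he, hsup.trans (mul_sqrt_rpow_le hd hη0.le (by positivity) (by positivity)
      (by positivity))⟩
  obtain ⟨ε, hε⟩ := skolem.1 key
  refine ⟨ε, ?_, ?_⟩
  · have hlim : Tendsto (fun d : ℕ => 2 * (β ^ 2 + 1) * (d : ℝ) ^ (η - δ)) atTop (nhds 0) := by
      simpa using (tendsto_natCast_rpow_of_neg
        (by linarith : η - δ < 0)).const_mul (2 * (β ^ 2 + 1))
    refine squeeze_zero_norm' ?_ hlim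
    filter_upwards [hε, eventually_gt_atTop 0] with d h hd
    have hd' : (0 : ℝ) < d := by exact_mod_cast hd
    rw [Real.norm_eq_abs, abs_mul, abs_of_nonneg (by positivity)]
    calc _ ≤ (d : ℝ) ^ ((1 : ℝ) / 2 - δ) * (2 * ((β ^ 2 + 1) * (d : ℝ) ^ (-1 / 2 + η))) := by
          gcongr
          exact h.1
      _ = 2 * (β ^ 2 + 1) * ((d : ℝ) ^ ((1 : ℝ) / 2 - δ) * (d : ℝ) ^ (-1 / 2 + η)) := by ring
      _ = _ := by
        rw [← rpow_add hd']
        ring_nf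
  · have hlim := (tendsto_natCast_rpow_of_neg
      (by linarith : -1 / 4 + 3 / 2 * η < 0)).const_mul
        (4 * (β ^ 2 + 1) * √(exp (β ^ 2) * (1 + 4 * β ^ 2) + exp (β ^ 2)))
    rw [mul_zero] at hlim
    exact squeeze_zero' (Eventually.of_forall fun d => Real.iSup_nonneg fun i => abs_nonneg _)
      (hε.mono fun d h => h.2) hlim
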